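/- Let ε = 10^{-3}, let u_1, …, u_s be unit vectors in ℝⁿ, c_1, …, c_s > 0, and u ∈ ℝⁿ satisfy I_n ⪯ Σ_{j=1}^s c_j (u_j + u) ⊗ (u_j + u) ⪯ (4 + ε) I_n, Σ_{j=1}^s c_j (u_j + u) = 0, and ‖u‖² ≤ ε / (Σ_{j=1}^s c_j). Define v_j = √(n/(n+1)) · (−u_j, 1/√n) ∈ ℝ^{n+1} and b_j = ((n+1)/n) c_j. Then (1/2) I_{n+1} ⪯ Σ_{j=1}^s b_j v_j ⊗ v_j ⪯ 5 I_{n+1}. -/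

import Mathlib

open scoped Matrix

theorem dotProduct_sum_smul_vecMulVec_mulVec {ι κ : Type*} [Fintype ι] [Fintype κ]
    (c : ι → ℝ) (a : ι → κ → ℝ) (x : κ → ℝ) :
    x ⬝ᵥ (∑ j, c j • Matrix.vecMulVec (a j) (a j)).mulVec x = ∑ j, c j * (a j ⬝ᵥ x) ^ 2 := by
  rw [Matrix.sum_mulVec, dotProduct_sum]
  refine Finset.sum_congr rfl fun j _ => ?_
  rw [Matrix.smul_mulVec, dotProduct_smul, Matrix.vecMulVec_mulVec, op_smul_eq_smul,
    dotProduct_smul, dotProduct_comm x, smul_eq_mul, smul_eq_mul]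
  ring

/-- Summing a quadratic form over the standard basis gives the trace. -/
theorem sum_sum_mul_dotProduct_single_sq {ι κ : Type*} [Fintype ι] [Fintype κ] [DecidableEq κ]
    (c : ι → ℝ) (a : ι → κ → ℝ) :
    ∑ i, ∑ j, c j * (a j ⬝ᵥ Pi.single i 1) ^ 2 = ∑ j, c j * (a j ⬝ᵥ a j) := by
  rw [Finset.sum_comm]
  refine Finset.sum_congr rfl fun j _ => ?_
  simp only [dotProduct_single_one]
  rw [dotProduct, Finset.mul_sum]
  simp only [sq]

theorem sum_mul_dotProduct_eq_zero {ι κ : Type*} [Fintype ι] [Fintype κ]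
    (c : ι → ℝ) (a : ι → κ → ℝ) (h : ∑ j, c j • a j = 0) (x : κ → ℝ) :
    ∑ j, c j * (a j ⬝ᵥ x) = 0 := by
  simpa only [sum_dotProduct, smul_dotProduct, smul_eq_mul, zero_dotProduct]
    using congrArg (· ⬝ᵥ x) h

/-- The trace of a centred sum of rank-one operators with unit vectors shifted by `w`. -/
theorem sum_mul_dotProduct_add_self {ι κ : Type*} [Fintype ι] [Fintype κ]
    (c : ι → ℝ) (u : ι → κ → ℝ) (w : κ → ℝ) (hu : ∀ j, u j ⬝ᵥ u j = 1)
    (h : ∑ j, c j • (u j + w) = 0) :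
    ∑ j, c j * ((u j + w) ⬝ᵥ (u j + w)) = (∑ j, c j) * (1 - w ⬝ᵥ w) := by
  have hw : ∑ j, c j * ((u j + w) ⬝ᵥ w) = 0 :=
    sum_mul_dotProduct_eq_zero c _ h w
  have key : ∀ j, c j * ((u j + w) ⬝ᵥ (u j + w)) =
      c j * (1 - w ⬝ᵥ w) + 2 * (c j * ((u j + w) ⬝ᵥ w)) := by
    intro j
    simp only [add_dotProduct, dotProduct_add, hu, dotProduct_comm w (u j)]
    ring
  simp_rw [key]
  rw [Finset.sum_add_distrib, ← Finset.mul_sum, hw, ← Finset.sum_mul]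
  ring

theorem dotProduct_sq_le {κ : Type*} [Fintype κ] (x y : κ → ℝ) :
    (x ⬝ᵥ y) ^ 2 ≤ (x ⬝ᵥ x) * (y ⬝ᵥ y) := by
  simpa [dotProduct, sq] using Finset.sum_mul_sq_le_sq_mul_sq Finset.univ x y

theorem sum_mul_sub_sq_of_sum_eq_zero {ι : Type*} [Fintype ι] (c p : ι → ℝ) (d : ℝ)
    (h : ∑ j, c j * p j = 0) :
    ∑ j, c j * (d - p j) ^ 2 = ∑ j, c j * p j ^ 2 + (∑ j, c j) * d ^ 2 := by
  have key : ∀ j, c j * (d - p j) ^ 2 = c j * p j ^ 2 + c j * d ^ 2 - 2 * d * (c j * p j) := by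
    intro j; ring
  simp_rw [key]
  rw [Finset.sum_sub_distrib, Finset.sum_add_distrib, ← Finset.mul_sum, h, ← Finset.sum_mul]
  ring

theorem dotProduct_fin_snoc {n : ℕ} (a : Fin n → ℝ) (r : ℝ) (y : Fin (n + 1) → ℝ) :
    (Fin.snoc a r : Fin (n + 1) → ℝ) ⬝ᵥ y = a ⬝ᵥ Fin.init y + r * y (Fin.last n) := by
  simp [dotProduct, Fin.sum_univ_castSucc, Fin.init]

/-- With `ε = 10⁻³` and the hypotheses of Srivastava's theorem in `ℝⁿ`, the lifted vectors
`vⱼ = √(n/(n+1)) ((−uⱼ), 1/√n)` in `ℝ^{n+1}` with weights `bⱼ = ((n+1)/n) cⱼ` satisfy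
`(1/2) I_{n+1} ⪯ Σ bⱼ vⱼ ⊗ vⱼ ⪯ 5 I_{n+1}`. -/
theorem lifted_decomposition_bounds_eps (n s : ℕ) (hn : 0 < n)
    (ε : ℝ) (hε : ε = 10 ^ (-3 : ℤ))
    (u : Fin s → Fin n → ℝ) (hu : ∀ j, u j ⬝ᵥ u j = 1)
    (c : Fin s → ℝ) (hc : ∀ j, 0 < c j) (w : Fin n → ℝ)
    (h1 : ∀ x : Fin n → ℝ,
      x ⬝ᵥ x ≤ x ⬝ᵥ (∑ j, c j • Matrix.vecMulVec (u j + w) (u j + w)).mulVec x)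
    (h2 : ∀ x : Fin n → ℝ,
      x ⬝ᵥ (∑ j, c j • Matrix.vecMulVec (u j + w) (u j + w)).mulVec x ≤ (4 + ε) * (x ⬝ᵥ x))
    (h3 : ∑ j, c j • (u j + w) = 0)
    (h4 : w ⬝ᵥ w ≤ ε / ∑ j, c j)
    (v : Fin s → Fin (n + 1) → ℝ)
    (hv : ∀ j, v j = Real.sqrt ((n : ℝ) / (n + 1)) • (Fin.snoc (-(u j)) (1 / Real.sqrt n) : Fin (n + 1) → ℝ))
    (b : Fin s → ℝ) (hb : ∀ j, b j = (((n : ℝ) + 1) / n) * c j) :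
    (∀ y : Fin (n + 1) → ℝ,
      (1 / 2) * (y ⬝ᵥ y) ≤ y ⬝ᵥ (∑ j, b j • Matrix.vecMulVec (v j) (v j)).mulVec y) ∧
    (∀ y : Fin (n + 1) → ℝ,
      y ⬝ᵥ (∑ j, b j • Matrix.vecMulVec (v j) (v j)).mulVec y ≤ 5 * (y ⬝ᵥ y)) := by
  have hn' : (0 : ℝ) < n := by exact_mod_cast hn
  have hε' : ε = 1 / 1000 := by rw [hε]; norm_num
  simp only [dotProduct_sum_smul_vecMulVec_mulVec] at h1 h2 ⊢
  set C := ∑ j, c j with hC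
  have hC0 : 0 ≤ C := Finset.sum_nonneg fun j _ => (hc j).le
  have hw0 : 0 ≤ w ⬝ᵥ w := Finset.sum_nonneg fun i _ => mul_self_nonneg _
  have trace := sum_sum_mul_dotProduct_single_sq c (fun j => u j + w)
  rw [sum_mul_dotProduct_add_self c u w hu h3, ← hC] at trace
  have lower : (n : ℝ) ≤ C * (1 - w ⬝ᵥ w) := by
    rw [← trace]
    simpa using Finset.sum_le_sum fun i (_ : i ∈ Finset.univ) => h1 (Pi.single i 1)
  have upper : C * (1 - w ⬝ᵥ w) ≤ n * (4 + ε) := by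
    rw [← trace]
    simpa [mul_add] using Finset.sum_le_sum fun i (_ : i ∈ Finset.univ) => h2 (Pi.single i 1)
  have hCpos : 0 < C := by
    rcases hC0.eq_or_lt with h | h
    · rw [← h] at lower; linarith
    · exact h
  have hCw : C * (w ⬝ᵥ w) ≤ ε := by
    rwa [le_div_iff₀ hCpos, mul_comm] at h4
  have hn1 : (1 : ℝ) ≤ n := by exact_mod_cast hn
  have hCn : n ≤ C := by nlinarith
  have hCn' : C ≤ n * (4 + 2 * ε) := by rw [hε'] at *; nlinarith
  have quad : ∀ y : Fin (n + 1) → ℝ, ∑ j, b j * (v j ⬝ᵥ y) ^ 2 =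
      ∑ j, c j * ((u j + w) ⬝ᵥ Fin.init y) ^ 2 +
        C * (w ⬝ᵥ Fin.init y + y (Fin.last n) / √n) ^ 2 := by
    intro y
    have h0 : ∑ j, c j * ((u j + w) ⬝ᵥ Fin.init y) = 0 :=
      sum_mul_dotProduct_eq_zero c _ h3 _
    rw [hC, ← sum_mul_sub_sq_of_sum_eq_zero _ _ _ h0]
    refine Finset.sum_congr rfl fun j _ => ?_
    rw [hb, hv, smul_dotProduct, dotProduct_fin_snoc, smul_eq_mul, mul_pow,
      Real.sq_sqrt (by positivity), neg_dotProduct, add_dotProduct]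
    field_simp
    ring
  have norm_sq : ∀ y : Fin (n + 1) → ℝ,
      y ⬝ᵥ y = Fin.init y ⬝ᵥ Fin.init y + y (Fin.last n) ^ 2 := by
    intro y
    simp [dotProduct, Fin.sum_univ_castSucc, Fin.init, sq]
  have shift : ∀ x : Fin n → ℝ, C * (w ⬝ᵥ x) ^ 2 ≤ ε * (x ⬝ᵥ x) := by
    intro x
    have hx0 : 0 ≤ x ⬝ᵥ x := Finset.sum_nonneg fun i _ => mul_self_nonneg _
    calc C * (w ⬝ᵥ x) ^ 2 ≤ C * ((w ⬝ᵥ w) * (x ⬝ᵥ x)) :=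
          mul_le_mul_of_nonneg_left (dotProduct_sq_le w x) hC0
      _ = C * (w ⬝ᵥ w) * (x ⬝ᵥ x) := by ring
      _ ≤ ε * (x ⬝ᵥ x) := mul_le_mul_of_nonneg_right hCw hx0
  have height : ∀ t : ℝ, t ^ 2 ≤ C * (t / √n) ^ 2 ∧ C * (t / √n) ^ 2 ≤ (4 + 2 * ε) * t ^ 2 := by
    intro t
    have ht : C * (t / √n) ^ 2 = C / n * t ^ 2 := by
      rw [div_pow, Real.sq_sqrt hn'.le]; ring
    rw [ht]
    constructor
    · exact le_mul_of_one_le_left (sq_nonneg t) ((one_le_div hn').2 hCn)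
    · exact mul_le_mul_of_nonneg_right ((div_le_iff₀ hn').2 (by linarith)) (sq_nonneg t)
  refine ⟨fun y => ?_, fun y => ?_⟩ <;>
  · rw [quad, norm_sq]
    have hx0 : 0 ≤ Fin.init y ⬝ᵥ Fin.init y := Finset.sum_nonneg fun i _ => mul_self_nonneg _
    have hx1 := h1 (Fin.init y)
    have hx2 := h2 (Fin.init y)
    have hs := shift (Fin.init y)
    obtain ⟨ht1, ht2⟩ := height (y (Fin.last n))
    have ht0 := sq_nonneg (y (Fin.last n))
    generalize w ⬝ᵥ Fin.init y = a at *
    generalize y (Fin.last n) / √n = τ at *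
    have hl := mul_nonneg hC0 (sq_nonneg (2 * a + τ))
    have hr := mul_nonneg hC0 (sq_nonneg (5 * a - τ))
    rw [hε'] at hx2 hs ht2
    linarith
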